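/- Let J be an almost complex structure on a neighborhood of 0 in ℂⁿ with J₀ = J_st and first-order coefficients L^i_{j̄k}, L^i_{j̄k̄}, and let ρ be a smooth real-valued function near 0 with ρ(z) = 2 Re zⁿ + O(|z|²), so that the J-invariant distribution of {ρ = 0} at 0 is D₀ = ℂ^{n−1}×{0}. For v = (v¹,…,v^{n−1},0) ∈ D₀, let L(v) and L_st(v) denote the Levi forms of {ρ = 0} at 0 with respect to J and with respect to J_st respectively. Then L(v) = L_st(v) + 2i·Σ_{α,β=1}^{n−1} conj(v^α)·v^β·(L^n_{ᾱβ} − conj(L^n_{β̄α})). -/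

import Mathlib

open Complex ComplexConjugate Finset

noncomputable section

/-- Standard complex structure of `ℂⁿ`: multiplication by `i`. -/
def Jstd (n : ℕ) : (Fin n → ℂ) →L[ℝ] (Fin n → ℂ) :=
  Complex.I • ContinuousLinearMap.id ℝ (Fin n → ℂ)

/-- The 1-form `θ := dρ ∘ J`. -/
def theta (n : ℕ) (ρ : (Fin n → ℂ) → ℝ)
    (J : (Fin n → ℂ) → ((Fin n → ℂ) →L[ℝ] (Fin n → ℂ)))
    (z : Fin n → ℂ) : (Fin n → ℂ) →L[ℝ] ℝ :=
  (fderiv ℝ ρ z).comp (J z)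

/-- Exterior derivative of the 1-form `θ`. -/
def dtheta (n : ℕ) (ρ : (Fin n → ℂ) → ℝ)
    (J : (Fin n → ℂ) → ((Fin n → ℂ) →L[ℝ] (Fin n → ℂ)))
    (z u w : Fin n → ℂ) : ℝ :=
  fderiv ℝ (theta n ρ J) z u w - fderiv ℝ (theta n ρ J) z w u

/-- Levi form of `{ρ = 0}` at `x` with respect to `J`: `L(v) = −dθ_x(v, J_x v)`. -/
def levi (n : ℕ) (ρ : (Fin n → ℂ) → ℝ)
    (J : (Fin n → ℂ) → ((Fin n → ℂ) →L[ℝ] (Fin n → ℂ)))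
    (x v : Fin n → ℂ) : ℝ :=
  - dtheta n ρ J x v (J x v)

/-- The product rule for `d(dρ ∘ J)`, applied to two vectors. -/
theorem fderiv_theta_apply (n : ℕ) (ρ : (Fin n → ℂ) → ℝ)
    (J : (Fin n → ℂ) → ((Fin n → ℂ) →L[ℝ] (Fin n → ℂ))) (x u w : Fin n → ℂ)
    (hρ : DifferentiableAt ℝ (fderiv ℝ ρ) x) (hJ : DifferentiableAt ℝ J x) :
    fderiv ℝ (theta n ρ J) x u w =
      fderiv ℝ ρ x (fderiv ℝ J x u w) + fderiv ℝ (fderiv ℝ ρ) x u (J x w) := by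
  have h := (hρ.hasFDerivAt.clm_comp hJ.hasFDerivAt).fderiv
  have h' : fderiv ℝ (theta n ρ J) x = _ := h
  rw [h']
  simp

/-- The difference of Levi forms at a point where `J` takes the standard value. -/
theorem levi_eq_levi_Jstd_add (n : ℕ) (ρ : (Fin n → ℂ) → ℝ)
    (J : (Fin n → ℂ) → ((Fin n → ℂ) →L[ℝ] (Fin n → ℂ))) (x v : Fin n → ℂ)
    (hρ : DifferentiableAt ℝ (fderiv ℝ ρ) x) (hJ : DifferentiableAt ℝ J x)
    (hJx : J x = Jstd n) :
    levi n ρ J x v = levi n ρ (fun _ => Jstd n) x v +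
      fderiv ℝ ρ x (fderiv ℝ J x (I • v) v - fderiv ℝ J x v (I • v)) := by
  have hv : Jstd n v = I • v := by simp [Jstd]
  simp only [levi, dtheta, fderiv_theta_apply n ρ J x _ _ hρ hJ,
    fderiv_theta_apply n ρ (fun _ => Jstd n) x _ _ hρ (differentiableAt_const _), hJx, hv,
    fderiv_fun_const, map_sub]
  simp
  ring

/-- comparison of the Levi forms at `0` with respect to `J` and `J_st`,
in terms of the first-order coefficients `L^n_{ᾱβ}` of `J`.  (The ambient space is
`ℂ^{n+1}`, greek indices run over `Fin n` via `Fin.castSucc`, and the distinguished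
last index is `Fin.last n`.) -/
theorem stmt5 (n : ℕ) (hn : 1 ≤ n)
    (U : Set (Fin (n+1) → ℂ)) (hUopen : IsOpen U) (hU0 : (0 : Fin (n+1) → ℂ) ∈ U)
    (J : (Fin (n+1) → ℂ) → ((Fin (n+1) → ℂ) →L[ℝ] (Fin (n+1) → ℂ)))
    (hJsmooth : ContDiffOn ℝ (⊤ : ℕ∞) J U)
    (hJacs : ∀ z ∈ U, ∀ v, J z (J z v) = -v)
    (hJ0 : J 0 = Jstd (n+1))
    (L1 L2 : Fin (n+1) → Fin (n+1) → Fin (n+1) → ℂ)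
    (hL : ∀ (z v : Fin (n+1) → ℂ) (i : Fin (n+1)),
      fderiv ℝ J 0 z v i =
        ∑ j, ∑ k, (L1 i j k * z k + L2 i j k * conj (z k)) * conj (v j))
    (ρ : (Fin (n+1) → ℂ) → ℝ) (hρ : ContDiffOn ℝ (⊤ : ℕ∞) ρ U)
    (hρ0 : ρ 0 = 0)
    (hdρ0 : fderiv ℝ ρ 0 =
      (2 : ℝ) • (Complex.reCLM.comp
        (ContinuousLinearMap.proj (Fin.last n) : (Fin (n+1) → ℂ) →L[ℝ] ℂ))) :
    ∀ v : Fin (n+1) → ℂ, v (Fin.last n) = 0 →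
      (levi (n+1) ρ J 0 v : ℂ) =
        (levi (n+1) ρ (fun _ => Jstd (n+1)) 0 v : ℂ) +
          2 * Complex.I * ∑ α : Fin n, ∑ β : Fin n,
            conj (v α.castSucc) * v β.castSucc *
              (L1 (Fin.last n) α.castSucc β.castSucc -
                conj (L1 (Fin.last n) β.castSucc α.castSucc)) := by
  intro v hv
  have hU : U ∈ nhds (0 : Fin (n+1) → ℂ) := hUopen.mem_nhds hU0
  have hJd : DifferentiableAt ℝ J 0 := (hJsmooth.contDiffAt hU).differentiableAt (by simp)
  have hρd : DifferentiableAt ℝ (fderiv ℝ ρ) 0 :=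
    ((hρ.contDiffAt hU).fderiv_right (m := 1) (by norm_cast)).differentiableAt (by simp)
  set S : ℂ := ∑ α : Fin n, ∑ β : Fin n,
    conj (v α.castSucc) * v β.castSucc * L1 (Fin.last n) α.castSucc β.castSucc with hS
  have hdiff : (fderiv ℝ J 0 (I • v) v - fderiv ℝ J 0 v (I • v)) (Fin.last n) =
      2 * I * S := by
    rw [Pi.sub_apply, hL, hL, ← Finset.sum_sub_distrib, Fin.sum_univ_castSucc, hS,
      Finset.mul_sum]
    simp only [hv, ← Finset.sum_sub_distrib, Fin.sum_univ_castSucc (n := n), Finset.mul_sum,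
      Pi.smul_apply, smul_eq_mul, map_mul, conj_I, map_zero, mul_zero, sub_zero, add_zero,
      Finset.sum_const_zero, zero_mul]
    refine Finset.sum_congr rfl fun α _ => Finset.sum_congr rfl fun β _ => ?_
    ring
  have hconj : ∑ α : Fin n, ∑ β : Fin n, conj (v α.castSucc) * v β.castSucc *
      conj (L1 (Fin.last n) β.castSucc α.castSucc) = conj S := by
    rw [hS, Finset.sum_comm]
    simp only [map_sum, map_mul, conj_conj]
    refine Finset.sum_congr rfl fun α _ => Finset.sum_congr rfl fun β _ => ?_
    ring
  have hsum : ∑ α : Fin n, ∑ β : Fin n, conj (v α.castSucc) * v β.castSucc *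
      (L1 (Fin.last n) α.castSucc β.castSucc -
        conj (L1 (Fin.last n) β.castSucc α.castSucc)) = S - conj S := by
    simp only [mul_sub, Finset.sum_sub_distrib, hconj, hS]
  have hre : fderiv ℝ ρ 0 (fderiv ℝ J 0 (I • v) v - fderiv ℝ J 0 v (I • v)) =
      -4 * S.im := by
    have h : fderiv ℝ ρ 0 (fderiv ℝ J 0 (I • v) v - fderiv ℝ J 0 v (I • v)) =
        2 * ((fderiv ℝ J 0 (I • v) v - fderiv ℝ J 0 v (I • v)) (Fin.last n)).re := by
      rw [hdρ0]
      rfl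
    rw [h, hdiff]
    simp
    ring
  rw [levi_eq_levi_Jstd_add _ ρ J 0 v hρd hJd hJ0, hre, hsum, Complex.sub_conj]
  push_cast
  linear_combination (-4 * (S.im : ℂ)) * I_sq
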